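/- With t = α+β+γ, the sum δ + dim X + 1 + dim Y(α) + dim Y(β) + dim Y(γ) equals δ², where δ = -(2t-α)(2t-β)(2t-γ)/(αβγ), dim X = -δ(t+α)(t+β)(t+γ)/(αβγ), and dim Y(α) = t(2t-β)(2t-γ)(t+β)(t+γ)(2t-3α)/(α²βγ(α-β)(α-γ)) (and cyclically for β,γ). That is, the dimensions of the summands of L⊗L add up to (dim L)². -/

import Mathlib

/-- The dimensions of the summands of `L ⊗ L` in the Vogel plane add up to `(dim L)²`. -/
theorem vogel_dimension_sum {F : Type*} [Field F] [CharZero F]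
    (α β γ t δ dX Yα Yβ Yγ : F)
    (hα : α ≠ 0) (hβ : β ≠ 0) (hγ : γ ≠ 0)
    (hαβ : α - β ≠ 0) (hβγ : β - γ ≠ 0) (hαγ : α - γ ≠ 0)
    (ht : t = α + β + γ)
    (hδ : δ = -((2*t - α) * (2*t - β) * (2*t - γ)) / (α * β * γ))
    (hX : dX = -δ * ((t + α) * (t + β) * (t + γ)) / (α * β * γ))
    (hYα : Yα = t * (2*t - β) * (2*t - γ) * (t + β) * (t + γ) * (2*t - 3*α) /
      (α^2 * β * γ * (α - β) * (α - γ)))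
    (hYβ : Yβ = t * (2*t - α) * (2*t - γ) * (t + α) * (t + γ) * (2*t - 3*β) /
      (β^2 * α * γ * (β - α) * (β - γ)))
    (hYγ : Yγ = t * (2*t - α) * (2*t - β) * (t + α) * (t + β) * (2*t - 3*γ) /
      (γ^2 * α * β * (γ - α) * (γ - β))) :
    δ + dX + 1 + Yα + Yβ + Yγ = δ^2 := by
  rw [← neg_sub α β] at hYβ
  rw [← neg_sub α γ, ← neg_sub β γ] at hYγ
  subst hX hYα hYβ hYγ hδ ht
  field_simp
  ring
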